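/- arXiv:2510.05737 — 3 statements merged into one kernel-verified Lean document; each statement's English description precedes it below -/
import Mathlib

section
/- Let k = 12ℓ + k' with k' ∈ {4,6,8,10,14} and 0 ≤ m ≤ ℓ. Then the q-expansion coefficients of f_{k,m}^{12} and of the Miller basis form f_{12k, 12m} ∈ M_{12k} agree in all degrees d ≤ 12m + (ℓ − m); explicitly, f_{k,m}^{12} = q^{12m} + O(q^{ℓ + 11m + 1}) and f_{12k,12m} = q^{12m} + O(q^{k+1}), so both have coefficient δ_{d,12m} for all d ≤ 12m + (ℓ − m). Consequently, for every 1 ≤ n ≤ ℓ − m, the sum of the n-th powers of the zeros of the Faber polynomial of f_{12k,12m} equals 12 times the sum of the n-th powers of the zeros of the Faber polynomial of f_{k,m} plus 12 times the sum of the n-th powers of the j-values of the zeros of E_{k'} counted with multiplicity. -/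
open Complex Polynomial Real MeasureTheory Filter Topology

noncomputable section

/-- `q = e^{2πiz}`. -/
def qexp (z : ℂ) : ℂ := Complex.exp (2 * Real.pi * Complex.I * z)

/-- The normalized Eisenstein series `E_k(z) = (1/2) ∑_{gcd(c,d)=1} (cz+d)^{-k}`,
with the convention `E_0 = 1`. -/
def Eis (k : ℕ) (z : ℂ) : ℂ :=
  if k = 0 then 1
  else (1 / 2) * ∑' p : ℤ × ℤ, if Int.gcd p.1 p.2 = 1 then 1 / ((p.1 : ℂ) * z + (p.2 : ℂ)) ^ k else 0

/-- The modular discriminant `Δ(z) = q ∏_{n ≥ 1} (1 - q^n)^24`, `q = e^{2πiz}`. -/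
def Disc (z : ℂ) : ℂ := qexp z * ∏' n : ℕ, (1 - qexp z ^ (n + 1)) ^ 24

/-- The modular `j`-invariant `j = E₄³ / Δ`. -/
def jinv (z : ℂ) : ℂ := Eis 4 z ^ 3 / Disc z

/-- The coefficient of `q^d` in the Fourier/`q`-expansion of a `1`-periodic function
holomorphic on the upper half-plane, computed at height `1`. -/
def qCoeff (f : ℂ → ℂ) (d : ℤ) : ℂ :=
  ∫ x in (0:ℝ)..1,
    f (x + Complex.I) * Complex.exp (-(2 * Real.pi * Complex.I * d * (x + Complex.I)))

/-- `c_N(d)`: the coefficient of `q^d` in the Laurent expansion of `j^N`. -/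
def cj (N : ℕ) (d : ℤ) : ℂ := qCoeff (fun z => jinv z ^ N) d

/-- `A_n = (1/2π) ∫_{π/2}^{2π/3} j(e^{iθ})^n dθ`. -/
def Acoef (n : ℕ) : ℂ :=
  (1 / (2 * Real.pi)) *
    ∫ θ in (Real.pi / 2)..(2 * Real.pi / 3), jinv (Complex.exp (θ * Complex.I)) ^ n

/-- `B_n = -c_n(0)`, where `c_n(0)` is the coefficient of `q^0` in `j^n`. -/
def Bcoef (n : ℕ) : ℂ := - cj n 0

/-- `C_n(k') = 0` for `k' ∈ {0,4,8}` and `C_n(k') = -1728^n/2` for `k' ∈ {6,10,14}`. -/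
def Ccoef (n k' : ℕ) : ℂ := if k' = 6 ∨ k' = 10 ∨ k' = 14 then -(1728 : ℂ) ^ n / 2 else 0

/-- Real-valued version of `A_n` (recall `j` is real on the arc). -/
def AcoefR (n : ℕ) : ℝ :=
  (1 / (2 * Real.pi)) *
    ∫ θ in (Real.pi / 2)..(2 * Real.pi / 3), (jinv (Complex.exp (θ * Complex.I)) ^ n).re

/-- Real-valued version of `B_n = -c_n(0)` (recall `c_n(0)` is an integer). -/
def BcoefR (n : ℕ) : ℝ := - (cj n 0).re

/-- Real-valued version of `C_n(k')`. -/
def CcoefR (n k' : ℕ) : ℝ := if k' = 6 ∨ k' = 10 ∨ k' = 14 then -(1728 : ℝ) ^ n / 2 else 0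

/-- `f` is the `m`-th element `f_{k,m} = q^m + O(q^{ℓ+1})` of the Miller basis of `M_k`,
`k = 12ℓ + k'`: it is holomorphic on the upper half-plane, weight-`k` modular for
`SL₂(ℤ)`, and has a convergent `q`-expansion whose coefficients in degrees `≤ ℓ`
are `δ_{d,m}`. -/
def IsMillerForm (ℓ k' m : ℕ) (f : ℂ → ℂ) : Prop :=
  (∀ z : ℂ, 0 < z.im → DifferentiableAt ℂ f z) ∧
  (∀ z : ℂ, 0 < z.im → f (z + 1) = f z) ∧
  (∀ z : ℂ, 0 < z.im → f (-1 / z) = z ^ (12 * ℓ + k') * f z) ∧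
  (∃ a : ℕ → ℂ,
    (∀ z : ℂ, 0 < z.im →
      Summable (fun n : ℕ => a n * qexp z ^ n) ∧ f z = ∑' n : ℕ, a n * qexp z ^ n) ∧
    (∀ d : ℕ, d ≤ ℓ → a d = if d = m then 1 else 0))

/-- `F` is the Faber polynomial of `f = f_{k,m}`, `k = 12ℓ + k'`: the monic polynomial
of degree `ℓ - m` with `f = Δ^ℓ ⬝ E_{k'} ⬝ F(j)`. -/
def IsFaber (ℓ k' m : ℕ) (f : ℂ → ℂ) (F : Polynomial ℂ) : Prop :=
  F.Monic ∧ F.natDegree = ℓ - m ∧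
  ∀ z : ℂ, 0 < z.im → f z = Disc z ^ ℓ * Eis k' z * F.eval (jinv z)

/-- The sum of the `n`-th powers of the zeros of `F`, counted with multiplicity. -/
def powerSumRoots (F : Polynomial ℂ) (n : ℕ) : ℂ := (F.roots.map (fun x => x ^ n)).sum

/-- The (finite) solutions of `d_1 + 2 d_2 + ⋯ + n d_n = n` in nonnegative integers,
indexed by `Fin n` (so index `t : Fin n` stands for `d_{t+1}`).  Note any solution
automatically has `d_t ≤ n`. -/
def sols (n : ℕ) : Finset (Fin n → ℕ) :=
  (Fintype.piFinset fun _ : Fin n => Finset.range (n + 1)).filter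
    (fun d => ∑ t : Fin n, ((t : ℕ) + 1) * d t = n)

/-- The sum of the `n`-th powers of the `j`-values of the zeros of `E_{k'}`, counted
with (fractional, orbifold) multiplicity: for `k' ∈ {4,8,6,10,14}` the only zeros in
the fundamental domain are at `ρ = e^{2πi/3}` (where `j = 0`, contributing nothing)
and, when `k' ∈ {6,10,14}`, additionally at `i` (where `j = 1728`) with order `1/2`. -/
def eisJZeroPowerSum (k' n : ℕ) : ℂ :=
  if k' = 6 ∨ k' = 10 ∨ k' = 14 then (1728 : ℂ) ^ n / 2 else 0

namespace TwelfthAux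

open UpperHalfPlane ModularForm EisensteinSeries MatrixGroups

/-- Newton's identities for multisets. -/
lemma newton (s : Multiset ℂ) (k : ℕ) (h : 0 < k) :
    (s.map (fun x => x ^ k)).sum = (-1) ^ (k + 1) * k * s.esymm k -
    ∑ a ∈ Finset.HasAntidiagonal.antidiagonal k with a.1 ∈ Set.Ioo 0 k,
      (-1) ^ a.fst * s.esymm a.1 * (s.map (fun x => x ^ a.2)).sum := by
  obtain ⟨l, rfl⟩ := Quot.exists_rep s
  have key := congrArg (MvPolynomial.aeval l.get)
    (MvPolynomial.psum_eq_mul_esymm_sub_sum (Fin l.length) ℂ k h)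
  have hl : (Finset.univ.val.map l.get : Multiset ℂ) = (l : Multiset ℂ) := by
    rw [Fin.univ_val_map]; simp
  have hp : ∀ n, MvPolynomial.aeval l.get (MvPolynomial.psum (Fin l.length) ℂ n)
      = ((l : Multiset ℂ).map (fun x => x ^ n)).sum := by
    intro n
    rw [← hl, Multiset.map_map]
    simp only [MvPolynomial.psum, map_sum, map_pow, MvPolynomial.aeval_X]
    rfl
  simp only [map_sub, map_mul, map_sum, map_pow, map_neg, map_one, map_natCast, hp,
    MvPolynomial.aeval_esymm_eq_multiset_esymm, hl] at key
  exact key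

lemma psum_eq (s t : Multiset ℂ) (N : ℕ) (h : ∀ i ≤ N, s.esymm i = t.esymm i) :
    ∀ n, 1 ≤ n → n ≤ N → (s.map (fun x => x ^ n)).sum = (t.map (fun x => x ^ n)).sum := by
  intro n
  induction n using Nat.strong_induction_on with
  | _ n ih =>
    intro h1 hN
    rw [newton s n h1, newton t n h1, h n hN]
    congr 1
    apply Finset.sum_congr rfl
    intro a ha
    simp only [Finset.mem_filter, Finset.HasAntidiagonal.mem_antidiagonal, Set.mem_Ioo] at ha
    rw [h a.1 (by omega), ih a.2 (by omega) (by omega) (by omega)]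

lemma roots_psum_eq (P G : ℂ[X]) (hP : P.Monic) (hG : G.Monic)
    (hd : P.natDegree = G.natDegree) (N : ℕ) (hN : N ≤ G.natDegree)
    (h : P - G = 0 ∨ (P - G).natDegree + N < G.natDegree) (n : ℕ) (h1 : 1 ≤ n) (hn : n ≤ N) :
    powerSumRoots G n = powerSumRoots P n := by
  refine psum_eq _ _ N (fun i hi => ?_) n h1 hn
  have hc : G.coeff (G.natDegree - i) = P.coeff (G.natDegree - i) := by
    rcases h with h | h
    · rw [sub_eq_zero.mp h]
    · have := Polynomial.coeff_eq_zero_of_natDegree_lt (p := P - G) (n := G.natDegree - i)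
        (by omega)
      rw [Polynomial.coeff_sub, sub_eq_zero] at this
      exact this.symm
  have e1 := Polynomial.coeff_eq_esymm_roots_of_splits (IsAlgClosed.splits G)
    (k := G.natDegree - i) (by omega)
  have e2 := Polynomial.coeff_eq_esymm_roots_of_splits (IsAlgClosed.splits P)
    (k := G.natDegree - i) (by omega)
  rw [hG.leadingCoeff, show G.natDegree - (G.natDegree - i) = i by omega] at e1
  rw [hP.leadingCoeff, hd, show G.natDegree - (G.natDegree - i) = i by omega] at e2
  rw [e1, e2, one_mul] at hc
  exact mul_left_cancel₀ (pow_ne_zero _ (by norm_num)) hc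

lemma hasSum_congr_aux {f g : ℕ → ℂ} {x : ℂ} (h : ∀ n, f n = g n) :
    HasSum f x ↔ HasSum g x := by
  rw [funext h]

/-- `f` has `q`-expansion `p`. -/
def HasQ (f : ℍ → ℂ) (p : PowerSeries ℂ) : Prop :=
  ∀ z : ℍ, HasSum (fun n => p.coeff n * qexp z ^ n) (f z)

lemma qexp_eq (z : ℂ) : qexp z = Function.Periodic.qParam 1 z := by
  simp [qexp, Function.Periodic.qParam]

lemma HasQ.mul {f g : ℍ → ℂ} {p r : PowerSeries ℂ} (hf : HasQ f p) (hg : HasQ g r) :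
    HasQ (f * g) (p * r) := by
  intro z
  have h1 := (hf z).summable.norm
  have h2 := (hg z).summable.norm
  have h3 := (summable_norm_sum_mul_antidiagonal_of_summable_norm h1 h2).of_norm.hasSum
  rw [← tsum_mul_tsum_eq_tsum_sum_antidiagonal_of_summable_norm h1 h2, (hf z).tsum_eq,
    (hg z).tsum_eq] at h3
  refine (hasSum_congr_aux (fun n => ?_)).mpr h3
  rw [PowerSeries.coeff_mul, Finset.sum_mul]
  apply Finset.sum_congr rfl
  intro a ha
  rw [← Finset.HasAntidiagonal.mem_antidiagonal.mp ha, pow_add]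
  ring

lemma HasQ.sub {f g : ℍ → ℂ} {p r : PowerSeries ℂ} (hf : HasQ f p) (hg : HasQ g r) :
    HasQ (f - g) (p - r) := by
  intro z
  refine (hasSum_congr_aux (fun n => ?_)).mpr ((hf z).sub (hg z))
  simp [sub_mul]

lemma HasQ.one : HasQ 1 1 := by
  intro z
  refine (hasSum_congr_aux (fun n => ?_)).mpr (hasSum_ite_eq (0 : ℕ) (1 : ℂ))
  rw [PowerSeries.coeff_one]
  split_ifs with h <;> simp [h]

lemma HasQ.pow {f : ℍ → ℂ} {p : PowerSeries ℂ} (hf : HasQ f p) (n : ℕ) :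
    HasQ (f ^ n) (p ^ n) := by
  induction n with
  | zero => simpa using HasQ.one
  | succ n ih => rw [pow_succ, pow_succ]; exact ih.mul hf

lemma HasQ.unique {f : ℍ → ℂ} {p r : PowerSeries ℂ} (hf : HasQ f p) (hg : HasQ f r) :
    p = r := by
  have h := hf.sub hg
  ext n
  have := ModularFormClass.qExpansion_coeff_unique (f := (0 : ModularForm 𝒮ℒ 0))
    (c := fun n => (p - r).coeff n) one_pos one_mem_strictPeriods_SL (by
      intro z
      have := h z
      rw [sub_self] at this
      simpa [qexp_eq] using this) n
  simp [qExpansion_zero] at this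
  exact sub_eq_zero.mp this

lemma HasQ.bounded {f : ℍ → ℂ} {p : PowerSeries ℂ} (hf : HasQ f p) (N : ℕ)
    (hp : ∀ n < N, p.coeff n = 0) :
    ∃ u : ℍ → ℂ, IsBoundedAtImInfty u ∧ ∀ z : ℍ, f z = qexp z ^ N * u z := by
  have hq : ∀ z : ℂ, qexp z ≠ 0 := fun z => Complex.exp_ne_zero _
  refine ⟨fun z => f z / qexp z ^ N, ?_, fun z => ?_⟩
  · refine isBoundedAtImInfty_of_hasSum_qExpansion (h := 1) (c := fun n => p.coeff (n + N))
      one_pos (fun z => ?_)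
    have h1 := hf z
    rw [← hasSum_nat_add_iff' N, Finset.sum_eq_zero, sub_zero] at h1
    · refine (hasSum_congr_aux (fun n => ?_)).mpr (h1.div_const (qexp z ^ N))
      rw [← qexp_eq, smul_eq_mul, pow_add]
      field_simp [hq]
    · intro i hi
      rw [hp i (Finset.mem_range.mp hi), zero_mul]
  · field_simp [hq]

lemma qexp_tendsto : Tendsto (fun z : ℍ => qexp z) atImInfty (𝓝 0) := by
  simpa [qexp_eq] using qParam_tendsto_atImInfty (h := 1) one_pos

lemma tendsto_q_pow_mul {u : ℍ → ℂ} (hu : IsBoundedAtImInfty u) (n : ℕ) (hn : 0 < n) :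
    Tendsto (fun z : ℍ => qexp z ^ n * u z) atImInfty (𝓝 0) := by
  have h1 : Tendsto (fun z : ℍ => qexp z ^ n) atImInfty (𝓝 0) := by
    simpa [hn.ne'] using qexp_tendsto.pow n
  have hu' : u =O[atImInfty] (1 : ℍ → ℝ) := hu
  have h2 := ((Asymptotics.isLittleO_one_iff ℝ).mpr h1).mul_isBigO hu'
  simpa [Asymptotics.isLittleO_one_iff] using h2

lemma HasQ.tendsto {f : ℍ → ℂ} {p : PowerSeries ℂ} (hf : HasQ f p) (hp : p.coeff 0 = 1) :
    Tendsto f atImInfty (𝓝 1) := by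
  obtain ⟨u, hu, h⟩ := (hf.sub HasQ.one).bounded 1 (by
    intro n hn
    obtain rfl : n = 0 := by omega
    simp only [map_sub, hp]; simp)
  have h2 := (tendsto_q_pow_mul hu 1 one_pos).add_const 1
  rw [zero_add] at h2
  refine h2.congr (fun z => ?_)
  rw [← h z]; simp

lemma Eis_eq {k : ℕ} (hk : 3 ≤ k) (z : ℍ) : Eis k z = E hk z := by
  rw [show E hk z = (1 / 2 : ℂ) • eisensteinSeriesSIF (N := 1) 0 k z from rfl,
    eisensteinSeriesSIF_apply 0 k z, eisensteinSeries, Eis, if_neg (by omega), smul_eq_mul]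
  congr 1
  rw [tsum_subtype (gammaSet 1 1 0) (fun v => eisSummand k v z),
    ← (finTwoArrowEquiv ℤ).symm.tsum_eq]
  apply tsum_congr
  intro p
  rw [finTwoArrowEquiv_symm_apply, Set.indicator]
  have : (![p.1, p.2] ∈ gammaSet 1 1 0) ↔ Int.gcd p.1 p.2 = 1 := by
    rw [gammaSet_one_mem_iff]; simp
  simp only [this, eisSummand]
  simp

lemma Disc_eq (z : ℍ) : Disc z = discriminant z := by
  rw [discriminant_eq_q_prod, Disc]
  simp [qexp_eq, eta_q]

lemma Disc_ne (z : ℍ) : Disc z ≠ 0 := by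
  rw [Disc_eq]; exact discriminant_ne_zero z

lemma E6_sq (z : ℍ) : Eis 6 z ^ 2 = Eis 4 z ^ 3 - 1728 * Disc z := by
  rw [Disc_eq, Eis_eq (by norm_num : 3 ≤ 6), Eis_eq (by norm_num : 3 ≤ 4),
    discriminant_eq_E₄_cube_sub_E₆_sq]
  ring

lemma E4_cube (z : ℍ) : Eis 4 z ^ 3 = Disc z * jinv z := by
  rw [jinv]; field_simp [Disc_ne z]

lemma E6_sq' (z : ℍ) : Eis 6 z ^ 2 = Disc z * (jinv z - 1728) := by
  rw [E6_sq, E4_cube]; ring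

/-- A level one form in a one-dimensional space with constant coefficient one is `E`. -/
lemma eq_E {k : ℕ} (hk : 3 ≤ k) (hk2 : Even k) (hr : Module.rank ℂ (ModularForm 𝒮ℒ k) = 1)
    (f : ModularForm 𝒮ℒ k) (hf : (qExpansion 1 f).coeff 0 = 1) (z : ℍ) : E hk z = f z := by
  obtain ⟨c, hc⟩ := (finrank_eq_one_iff_of_nonzero' (E hk) (E_ne_zero hk hk2)).mp
      (Module.rank_eq_one_iff_finrank_eq_one.mp hr) f
  have h1 := ModularForm.qExpansion_smul one_pos one_mem_strictPeriods_SL c (E hk)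
  rw [show (c • ⇑(E hk) : ℍ → ℂ) = f from congrArg DFunLike.coe hc] at h1
  have h2 := congrArg (fun p => PowerSeries.coeff 0 p) h1
  simp only [hf, PowerSeries.coeff_smul, E_qExpansion_coeff_zero hk hk2] at h2
  have : c = 1 := by simpa using h2.symm
  rw [← hc, this, one_smul]

lemma E8 (z : ℍ) : Eis 8 z = Eis 4 z ^ 2 := by
  rw [Eis_eq (by norm_num : 3 ≤ 8), Eis_eq (by norm_num : 3 ≤ 4)]
  have := eq_E (by norm_num : 3 ≤ 8) ⟨4, rfl⟩ (by
    rw [dimension_level_one 8 ⟨4, rfl⟩]; simp [Nat.ModEq])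
    (ModularForm.mcast (by decide) (E₄.pow 2)) (by
      simp only [ModularForm.qExpansion_mcast,
        ModularForm.qExpansion_pow one_pos one_mem_strictPeriods_SL]
      simp [pow_succ, PowerSeries.coeff_mul, -PowerSeries.coeff_zero_eq_constantCoeff,
        E_qExpansion_coeff_zero _ ⟨2, rfl⟩]) z
  rw [this]
  simp only [coe_mcast, ModularForm.coe_pow, Pi.pow_apply]

lemma E10 (z : ℍ) : Eis 10 z = Eis 4 z * Eis 6 z := by
  rw [Eis_eq (by norm_num : 3 ≤ 10), Eis_eq (by norm_num : 3 ≤ 4), Eis_eq (by norm_num : 3 ≤ 6)]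
  have := eq_E (by norm_num : 3 ≤ 10) ⟨5, rfl⟩ (by
    rw [dimension_level_one 10 ⟨5, rfl⟩]; simp [Nat.ModEq])
    (ModularForm.mcast (by decide) (E₄.mul E₆)) (by
      simp only [ModularForm.qExpansion_mcast,
        ModularForm.qExpansion_mul one_pos one_mem_strictPeriods_SL]
      simp [PowerSeries.coeff_mul, -PowerSeries.coeff_zero_eq_constantCoeff,
        E_qExpansion_coeff_zero _ ⟨2, rfl⟩, E_qExpansion_coeff_zero _ ⟨3, rfl⟩]) z
  rw [this]
  simp only [coe_mcast, ModularForm.coe_mul, Pi.mul_apply]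

lemma E14 (z : ℍ) : Eis 14 z = Eis 4 z ^ 2 * Eis 6 z := by
  rw [Eis_eq (by norm_num : 3 ≤ 14), Eis_eq (by norm_num : 3 ≤ 4), Eis_eq (by norm_num : 3 ≤ 6)]
  have := eq_E (by norm_num : 3 ≤ 14) ⟨7, rfl⟩ (by
    rw [dimension_level_one 14 ⟨7, rfl⟩]; simp [Nat.ModEq])
    (ModularForm.mcast (by decide) ((E₄.pow 2).mul E₆)) (by
      simp only [ModularForm.qExpansion_mcast,
        ModularForm.qExpansion_mul one_pos one_mem_strictPeriods_SL,
        ModularForm.qExpansion_pow one_pos one_mem_strictPeriods_SL]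
      simp [pow_succ, PowerSeries.coeff_mul, -PowerSeries.coeff_zero_eq_constantCoeff,
        E_qExpansion_coeff_zero _ ⟨2, rfl⟩, E_qExpansion_coeff_zero _ ⟨3, rfl⟩]) z
  rw [this]
  simp only [coe_mcast, ModularForm.coe_mul, ModularForm.coe_pow, Pi.mul_apply, Pi.pow_apply]

/-- `E_{k'}^{12} = Δ^{k'} j^a (j - 1728)^b`. -/
lemma Eis_pow (k' : ℕ) (hk' : k' = 4 ∨ k' = 6 ∨ k' = 8 ∨ k' = 10 ∨ k' = 14) :
    ∃ a b : ℕ, a + b = k' ∧ (∀ n, (b : ℂ) * 1728 ^ n = 12 * eisJZeroPowerSum k' n) ∧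
      ∀ z : ℍ, Eis k' z ^ 12 = Disc z ^ k' * (jinv z ^ a * (jinv z - 1728) ^ b) := by
  rcases hk' with rfl | rfl | rfl | rfl | rfl
  · refine ⟨4, 0, rfl, fun n => by simp [eisJZeroPowerSum], fun z => ?_⟩
    rw [show Eis 4 z ^ 12 = (Eis 4 z ^ 3) ^ 4 by ring, E4_cube]; ring
  · refine ⟨0, 6, rfl, fun n => by simp [eisJZeroPowerSum]; ring, fun z => ?_⟩
    rw [show Eis 6 z ^ 12 = (Eis 6 z ^ 2) ^ 6 by ring, E6_sq']; ring
  · refine ⟨8, 0, rfl, fun n => by simp [eisJZeroPowerSum], fun z => ?_⟩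
    rw [E8, show (Eis 4 z ^ 2) ^ 12 = (Eis 4 z ^ 3) ^ 8 by ring, E4_cube]; ring
  · refine ⟨4, 6, rfl, fun n => by simp [eisJZeroPowerSum]; ring, fun z => ?_⟩
    rw [E10, show (Eis 4 z * Eis 6 z) ^ 12 = (Eis 4 z ^ 3) ^ 4 * (Eis 6 z ^ 2) ^ 6 by ring,
      E4_cube, E6_sq']; ring
  · refine ⟨8, 6, rfl, fun n => by simp [eisJZeroPowerSum]; ring, fun z => ?_⟩
    rw [E14, show (Eis 4 z ^ 2 * Eis 6 z) ^ 12 = (Eis 4 z ^ 3) ^ 8 * (Eis 6 z ^ 2) ^ 6 by ring,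
      E4_cube, E6_sq']; ring

lemma E4_tendsto : Tendsto (fun z : ℍ => Eis 4 z) atImInfty (𝓝 1) := by
  have h : HasQ (fun z : ℍ => Eis 4 z) (qExpansion 1 E₄) := by
    intro z
    show HasSum _ (Eis 4 z)
    rw [Eis_eq (by norm_num : 3 ≤ 4)]
    simpa [qexp_eq] using
      ModularForm.hasSum_qExpansion (f := E₄) one_pos one_mem_strictPeriods_SL z
  exact h.tendsto (E_qExpansion_coeff_zero _ ⟨2, rfl⟩)

/-- The product factor of the discriminant. -/
def W (z : ℍ) : ℂ := ∏' n : ℕ, (1 - qexp z ^ (n + 1)) ^ 24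

lemma Disc_eq_W (z : ℍ) : Disc z = qexp z * W z := rfl

lemma W_tendsto : Tendsto W atImInfty (𝓝 1) := by
  refine tendsto_atImInfty_tprod_one_sub_eta_q_pow.congr (fun z => ?_)
  simp [W, qexp_eq, eta_q]

lemma qj_tendsto : Tendsto (fun z : ℍ => qexp z * jinv z) atImInfty (𝓝 1) := by
  have h := (E4_tendsto.pow 3).div W_tendsto one_ne_zero
  simp only [one_pow, div_one] at h
  refine h.congr (fun z => ?_)
  have hd := Disc_ne z
  rw [Disc_eq_W] at hd
  have h1 := left_ne_zero_of_mul hd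
  have h2 := right_ne_zero_of_mul hd
  rw [Pi.div_apply, jinv, Disc_eq_W]
  field_simp

lemma degree_bound (R : ℂ[X]) (hR : R ≠ 0) (K N : ℕ) (u : ℍ → ℂ) (hu : IsBoundedAtImInfty u)
    (h : ∀ z : ℍ, Disc z ^ K * R.eval (jinv z) = qexp z ^ N * u z) :
    R.natDegree + N ≤ K := by
  by_contra! hlt
  set r := R.natDegree with hr
  have h1 : Tendsto (fun z : ℍ => ∑ i ∈ Finset.range (r + 1),
      R.coeff i * (qexp z * jinv z) ^ i * qexp z ^ (r - i)) atImInfty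
      (𝓝 (∑ i ∈ Finset.range (r + 1), R.coeff i * 1 ^ i * 0 ^ (r - i))) :=
    tendsto_finsetSum _ fun i _ =>
      ((qj_tendsto.pow i).const_mul (R.coeff i)).mul (qexp_tendsto.pow (r - i))
  have e1 : (∑ i ∈ Finset.range (r + 1), R.coeff i * 1 ^ i * (0 : ℂ) ^ (r - i))
      = R.leadingCoeff := by
    rw [Finset.sum_range_succ, Finset.sum_eq_zero]
    · simp [hr]
    · intro i hi
      rw [zero_pow (by have := Finset.mem_range.mp hi; omega), mul_zero]
  have e2 : ∀ z : ℍ, ∑ i ∈ Finset.range (r + 1),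
      R.coeff i * (qexp z * jinv z) ^ i * qexp z ^ (r - i) = qexp z ^ r * R.eval (jinv z) := by
    intro z
    rw [Polynomial.eval_eq_sum_range, Finset.mul_sum]
    apply Finset.sum_congr rfl
    intro i hi
    have hi' : i ≤ r := by have := Finset.mem_range.mp hi; omega
    rw [mul_pow, show qexp (z : ℂ) ^ r = qexp z ^ i * qexp z ^ (r - i) by
      rw [← pow_add]; congr 1; omega]
    ring
  rw [e1] at h1
  have h2 := (W_tendsto.pow K).mul h1
  rw [one_pow, one_mul] at h2
  have h3 := tendsto_q_pow_mul hu (r + N - K) (by omega)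
  have h4 := tendsto_nhds_unique h2 (h3.congr (fun z => by
    rw [e2]
    have hq : qexp (z : ℂ) ^ K ≠ 0 := pow_ne_zero _ (Complex.exp_ne_zero _)
    apply mul_left_cancel₀ hq
    have := h z
    rw [Disc_eq_W, mul_pow] at this
    calc qexp z ^ K * (qexp z ^ (r + N - K) * u z)
        = qexp z ^ r * (qexp z ^ N * u z) := by
          rw [← mul_assoc, ← pow_add, ← mul_assoc, ← pow_add]; congr 2; omega
      _ = _ := by rw [← this]; ring))
  exact hR (Polynomial.leadingCoeff_eq_zero.mp h4)

lemma coeff_pow_twelve (p : PowerSeries ℂ) (ℓ m : ℕ) (hm : m ≤ ℓ)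
    (hp : ∀ d ≤ ℓ, p.coeff d = if d = m then 1 else 0) (d : ℕ) (hd : d ≤ 12 * m + (ℓ - m)) :
    (p ^ 12).coeff d = if d = 12 * m then 1 else 0 := by
  have h1 : (PowerSeries.X : PowerSeries ℂ) ^ (ℓ + 1) ∣ p - PowerSeries.X ^ m := by
    rw [PowerSeries.X_pow_dvd_iff]
    intro i hi
    rw [map_sub, hp i (by omega), PowerSeries.coeff_X_pow, sub_self]
  obtain ⟨v, hv⟩ := h1
  set s := ℓ - m + 1 with hs
  have hpv : p = PowerSeries.X ^ m * (1 + PowerSeries.X ^ s * v) := by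
    rw [mul_add, ← mul_assoc, ← pow_add, show m + s = ℓ + 1 by omega, ← hv]; ring
  obtain ⟨w, hw⟩ : PowerSeries.X ^ s ∣ (1 + PowerSeries.X ^ s * v) ^ 12 - 1 ^ 12 := by
    refine dvd_trans ?_ (sub_dvd_pow_sub_pow _ _ 12)
    simp
  have hp12 : p ^ 12 = PowerSeries.X ^ (12 * m) + PowerSeries.X ^ (12 * m + s) * w := by
    rw [pow_add, mul_assoc, ← hw, hpv, mul_pow, ← pow_mul]; ring
  rw [hp12, map_add, PowerSeries.coeff_X_pow, PowerSeries.coeff_X_pow_mul',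
    if_neg (show ¬ 12 * m + s ≤ d by omega), add_zero]

lemma hasQ_of (f : ℂ → ℂ) (a : ℕ → ℂ) (h : ∀ z : ℂ, 0 < z.im →
      Summable (fun n : ℕ => a n * qexp z ^ n) ∧ f z = ∑' n : ℕ, a n * qexp z ^ n) :
    HasQ (fun z => f z) (PowerSeries.mk a) := by
  intro z
  obtain ⟨h1, h2⟩ := h z z.2
  simp only [PowerSeries.coeff_mk]
  rw [h2]
  exact h1.hasSum

end TwelfthAux

/-- Let `k = 12ℓ + k'` with `k' ∈ {4,6,8,10,14}` and `0 ≤ m ≤ ℓ`.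
The `q`-expansion coefficients of `f_{k,m}^{12}` and of `f_{12k,12m} ∈ M_{12k}` agree
in all degrees `d ≤ 12m + (ℓ - m)`, where both equal `δ_{d,12m}`.  Consequently, for
`1 ≤ n ≤ ℓ - m` the sum of the `n`-th powers of the zeros of the Faber polynomial of
`f_{12k,12m}` equals `12` times that of the Faber polynomial of `f_{k,m}` plus `12`
times the sum of the `n`-th powers of the `j`-values of the zeros of `E_{k'}`. -/
theorem twelfth_power_coeffs_and_power_sums (ℓ k' m : ℕ)
    (hk' : k' = 4 ∨ k' = 6 ∨ k' = 8 ∨ k' = 10 ∨ k' = 14) (hm : m ≤ ℓ)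
    (f g : ℂ → ℂ) (F G : Polynomial ℂ)
    (hf : IsMillerForm ℓ k' m f) (hF : IsFaber ℓ k' m f F)
    (hg : IsMillerForm (12 * ℓ + k') 0 (12 * m) g)
    (hG : IsFaber (12 * ℓ + k') 0 (12 * m) g G)
    (b a : ℕ → ℂ)
    (hb : ∀ z : ℂ, 0 < z.im →
      Summable (fun n : ℕ => b n * qexp z ^ n) ∧ (f z) ^ 12 = ∑' n : ℕ, b n * qexp z ^ n)
    (ha : ∀ z : ℂ, 0 < z.im →
      Summable (fun n : ℕ => a n * qexp z ^ n) ∧ g z = ∑' n : ℕ, a n * qexp z ^ n) :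
    (∀ d : ℕ, d ≤ 12 * m + (ℓ - m) →
      b d = a d ∧ b d = if d = 12 * m then 1 else 0) ∧
    (∀ n : ℕ, 1 ≤ n → n ≤ ℓ - m →
      powerSumRoots G n = 12 * powerSumRoots F n + 12 * eisJZeroPowerSum k' n) := by
  classical
  obtain ⟨c, hc, hcd⟩ := hf.2.2.2
  obtain ⟨e, he, hed⟩ := hg.2.2.2
  have Qf := TwelfthAux.hasQ_of f c hc
  have Qg := TwelfthAux.hasQ_of g a ha
  have Qb := TwelfthAux.hasQ_of (fun z => f z ^ 12) b hb
  have hbc : PowerSeries.mk b = (PowerSeries.mk c) ^ 12 := Qb.unique (Qf.pow 12)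
  have hae : PowerSeries.mk a = PowerSeries.mk e := Qg.unique (TwelfthAux.hasQ_of g e he)
  have hb' : ∀ d : ℕ, d ≤ 12 * m + (ℓ - m) → b d = if d = 12 * m then 1 else 0 := by
    intro d hd
    have := TwelfthAux.coeff_pow_twelve (PowerSeries.mk c) ℓ m hm
      (fun d hd => by rw [PowerSeries.coeff_mk]; exact hcd d hd) d hd
    rwa [← hbc, PowerSeries.coeff_mk] at this
  have ha' : ∀ d : ℕ, d ≤ 12 * m + (ℓ - m) → a d = if d = 12 * m then 1 else 0 := by
    intro d hd
    have := congrArg (fun p => PowerSeries.coeff d p) hae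
    simp only [PowerSeries.coeff_mk] at this
    rw [this, hed d (by omega)]
  refine ⟨fun d hd => ⟨by rw [hb' d hd, ha' d hd], hb' d hd⟩, ?_⟩
  intro n h1 hn
  obtain ⟨i, j, hij, hz, hE⟩ := TwelfthAux.Eis_pow k' hk'
  obtain ⟨hFm, hFd, hFf⟩ := hF
  obtain ⟨hGm, hGd, hGf⟩ := hG
  have hXm : (X ^ i * (X - C (1728 : ℂ)) ^ j).Monic :=
    (monic_X_pow i).mul ((monic_X_sub_C _).pow j)
  have hFpm : (F ^ 12).Monic := hFm.pow 12
  set P : ℂ[X] := F ^ 12 * (X ^ i * (X - C 1728) ^ j) with hP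
  have hPm : P.Monic := hFpm.mul hXm
  have hPd : P.natDegree = G.natDegree := by
    rw [hP, hFpm.natDegree_mul hXm, (monic_X_pow i).natDegree_mul ((monic_X_sub_C _).pow j),
      hFm.natDegree_pow, (monic_X_sub_C _).natDegree_pow, natDegree_X_pow, natDegree_X_sub_C,
      hFd, hGd]
    omega
  have hsum : powerSumRoots P n = 12 * powerSumRoots F n + 12 * eisJZeroPowerSum k' n := by
    rw [← hz n]
    unfold powerSumRoots
    rw [hP, roots_mul hPm.ne_zero, roots_mul hXm.ne_zero, roots_pow, roots_pow, roots_pow,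
      roots_X, roots_X_sub_C]
    have h0 : (0 : ℂ) ^ n = 0 := zero_pow (by omega)
    simp [Multiset.map_nsmul, Multiset.sum_nsmul, h0]
  rw [← hsum]
  obtain ⟨u, hu, hfg⟩ := (Qb.sub Qg).bounded (12 * m + (ℓ - m) + 1) (by
    intro d hd
    rw [map_sub, PowerSeries.coeff_mk, PowerSeries.coeff_mk, hb' d (by omega), ha' d (by omega),
      sub_self])
  refine TwelfthAux.roots_psum_eq P G hPm hGm hPd (ℓ - m) (by omega) ?_ n h1 hn
  by_cases hR : P - G = 0
  · exact Or.inl hR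
  · right
    have := TwelfthAux.degree_bound (P - G) hR (12 * ℓ + k') (12 * m + (ℓ - m) + 1) u hu (by
      intro z
      rw [← hfg z]
      show _ = f z ^ 12 - g z
      rw [hGf z z.2, hFf z z.2, mul_pow, mul_pow, hE z, Eis, if_pos rfl]
      simp only [hP, eval_sub, eval_mul, eval_pow, eval_X, eval_C]
      ring)
    omega
end
end

section
/- For every integer n ≥ 1, the quantity (1/2π) ∫_{π/2}^{2π/3} j(e^{iθ})^n dθ is an integer, where j is the modular j-invariant (which is real-valued on the arc {e^{iθ} : π/2 ≤ θ ≤ 2π/3}). -/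
open Complex Polynomial Real MeasureTheory Filter Topology

noncomputable section

/-- Holomorphic on the unit disc with integer Taylor coefficients at `0`. -/
def IA (f : ℂ → ℂ) : Prop :=
  DifferentiableOn ℂ f (Metric.ball 0 1) ∧
    ∀ m : ℕ, ∃ k : ℤ, iteratedDeriv m f 0 = (m.factorial : ℂ) * k

lemma IA_mem : (0 : ℂ) ∈ Metric.ball (0 : ℂ) 1 := Metric.mem_ball_self one_pos

lemma IA_nhds : Metric.ball (0 : ℂ) 1 ∈ 𝓝 (0 : ℂ) := Metric.ball_mem_nhds 0 one_pos

lemma IA_cd {f : ℂ → ℂ} (h : DifferentiableOn ℂ f (Metric.ball 0 1)) (m : ℕ) :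
    ContDiffAt ℂ m f 0 := (h.analyticAt IA_nhds).contDiffAt

lemma IA.congr {f g : ℂ → ℂ} (hf : IA f) (h : Set.EqOn g f (Metric.ball 0 1)) : IA g := by
  refine ⟨hf.1.congr h, fun m => ?_⟩
  obtain ⟨k, hk⟩ := hf.2 m
  refine ⟨k, ?_⟩
  rw [← hk]
  exact (h.eventuallyEq_of_mem IA_nhds).iteratedDeriv_eq m

lemma IA_const (c : ℤ) : IA (fun _ => (c : ℂ)) := by
  refine ⟨by fun_prop, fun m => ?_⟩
  rcases m with _ | m
  · exact ⟨c, by simp⟩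
  · exact ⟨0, by simp [iteratedDeriv_const]⟩

lemma IA_one : IA (fun _ => (1 : ℂ)) := by simpa using IA_const 1

lemma IA.add {f g : ℂ → ℂ} (hf : IA f) (hg : IA g) : IA (fun q => f q + g q) := by
  refine ⟨hf.1.add hg.1, fun m => ?_⟩
  obtain ⟨a, ha⟩ := hf.2 m
  obtain ⟨b, hb⟩ := hg.2 m
  refine ⟨a + b, ?_⟩
  rw [iteratedDeriv_fun_add (IA_cd hf.1 m) (IA_cd hg.1 m), ha, hb]
  push_cast; ring

lemma leib {f g : ℂ → ℂ} {a b : ℕ → ℂ} (m : ℕ) (hf : DifferentiableOn ℂ f (Metric.ball 0 1))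
    (hg : DifferentiableOn ℂ g (Metric.ball 0 1))
    (ha : ∀ i ≤ m, iteratedDeriv i f 0 = (i.factorial : ℂ) * a i)
    (hb : ∀ i ≤ m, iteratedDeriv i g 0 = (i.factorial : ℂ) * b i) :
    iteratedDeriv m (fun q => f q * g q) 0 =
      (m.factorial : ℂ) * ∑ i ∈ Finset.range (m + 1), a i * b (m - i) := by
  rw [iteratedDeriv_fun_mul (IA_cd hf m) (IA_cd hg m), Finset.mul_sum]
  refine Finset.sum_congr rfl fun i hi => ?_
  have him : i ≤ m := by simpa [Nat.lt_succ_iff] using hi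
  rw [ha i him, hb (m - i) (Nat.sub_le _ _), ← Nat.choose_mul_factorial_mul_factorial him]
  push_cast; ring

lemma IA.mul {f g : ℂ → ℂ} (hf : IA f) (hg : IA g) : IA (fun q => f q * g q) := by
  refine ⟨hf.1.mul hg.1, fun m => ?_⟩
  choose a ha using hf.2
  choose b hb using hg.2
  refine ⟨∑ i ∈ Finset.range (m + 1), a i * b (m - i), ?_⟩
  rw [leib (a := fun i => a i) (b := fun i => b i) m hf.1 hg.1 (fun i _ => ha i) (fun i _ => hb i)]
  push_cast; rfl

lemma IA.pow {f : ℂ → ℂ} (hf : IA f) (n : ℕ) : IA (fun q => f q ^ n) := by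
  induction n with
  | zero => simpa using IA_one
  | succ n ih => simpa [pow_succ] using ih.mul hf

lemma IA_id : IA (fun q => q) := by
  refine ⟨by fun_prop, fun m => ?_⟩
  rcases m with _ | _ | m
  · exact ⟨0, by simp⟩
  · exact ⟨1, by simp⟩
  · refine ⟨0, ?_⟩
    have h : deriv (fun x : ℂ => x) = fun _ => 1 := by ext; simp
    rw [iteratedDeriv_succ', h]
    simp [iteratedDeriv_const]

lemma IA.der {f : ℂ → ℂ} (hf : IA f) : IA (deriv f) := by
  refine ⟨hf.1.deriv Metric.isOpen_ball, fun m => ?_⟩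
  obtain ⟨k, hk⟩ := hf.2 (m + 1)
  refine ⟨(m + 1) * k, ?_⟩
  rw [← iteratedDeriv_succ', hk, Nat.factorial_succ]
  push_cast; ring

lemma IA.sum {f : ℕ → ℂ → ℂ} (hf : ∀ i, IA (f i)) (n : ℕ) :
    IA (fun q => ∑ i ∈ Finset.range n, f i q) := by
  induction n with
  | zero => simpa using IA_const 0
  | succ n ih => simpa [Finset.sum_range_succ] using ih.add (hf n)

lemma IA.prod {ι : Type*} {f : ι → ℂ → ℂ} (hf : ∀ i, IA (f i)) (s : Finset ι) :
    IA (fun q => ∏ i ∈ s, f i q) := by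
  classical
  induction s using Finset.induction_on with
  | empty => simpa using IA_one
  | insert a s h ih => simpa [Finset.prod_insert h] using (hf a).mul ih

lemma IA.inv {f : ℂ → ℂ} (hf : IA f) (h0 : f 0 = 1) (hn : ∀ q ∈ Metric.ball (0 : ℂ) 1, f q ≠ 0) :
    IA (fun q => (f q)⁻¹) := by
  have hd : DifferentiableOn ℂ (fun q => (f q)⁻¹) (Metric.ball 0 1) := hf.1.inv hn
  refine ⟨hd, fun m => ?_⟩
  choose a ha using hf.2
  set b : ℕ → ℂ := fun i => iteratedDeriv i (fun q => (f q)⁻¹) 0 / i.factorial with hb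
  have hb' : ∀ i, iteratedDeriv i (fun q => (f q)⁻¹) 0 = (i.factorial : ℂ) * b i := by
    intro i
    have : (i.factorial : ℂ) ≠ 0 := by exact_mod_cast i.factorial_ne_zero
    simp only [hb]; field_simp
  have ha0 : (a 0 : ℂ) = 1 := by
    have := ha 0
    simpa [h0] using this.symm
  suffices ∃ k : ℤ, b m = k by
    obtain ⟨k, hk⟩ := this
    exact ⟨k, by rw [hb', hk]⟩
  induction m using Nat.strong_induction_on with
  | _ m ih =>
    rcases m with _ | m
    · exact ⟨1, by simp [hb, h0]⟩
    · have h1 := leib (a := fun i => a i) (b := b) (m + 1) hf.1 hd (fun i _ => ha i) (fun i _ => hb' i)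
      have h2 : iteratedDeriv (m + 1) (fun q => f q * (f q)⁻¹) 0 = 0 := by
        have : (fun q => f q * (f q)⁻¹) =ᶠ[𝓝 0] fun _ => 1 := by
          filter_upwards [IA_nhds] with q hq
          exact mul_inv_cancel₀ (hn q hq)
        rw [this.iteratedDeriv_eq]
        simp [iteratedDeriv_const]
      rw [h2, Finset.sum_range_succ'] at h1
      have h3 : ((m + 1).factorial : ℂ) ≠ 0 := by exact_mod_cast (m + 1).factorial_ne_zero
      have h4 := (mul_eq_zero.1 h1.symm).resolve_left h3
      have h5 : ∀ i ∈ Finset.range (m + 1), ∃ k : ℤ, b (m + 1 - (i + 1)) = k :=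
        fun i hi => ih _ (by omega)
      choose! k hk using h5
      refine ⟨-∑ i ∈ Finset.range (m + 1), a (i + 1) * k i, ?_⟩
      rw [Finset.sum_congr rfl fun i hi => by rw [hk i hi]] at h4
      simp only [ha0, one_mul, Nat.sub_zero] at h4
      push_cast
      linear_combination h4

lemma IA.split {f : ℂ → ℂ} (hf : IA f) : ∃ (c : ℤ) (g : ℂ → ℂ), IA g ∧
    ∀ q, f q = c + q * g q := by
  obtain ⟨c, hc⟩ := hf.2 0
  have hc' : f 0 = c := by simpa using hc
  have hd : DifferentiableOn ℂ (dslope f 0) (Metric.ball 0 1) :=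
    (Complex.differentiableOn_dslope IA_nhds).2 hf.1
  have he : ∀ q, f q = c + q * dslope f 0 q := by
    intro q
    have := sub_smul_dslope f 0 q
    simp only [sub_zero, smul_eq_mul, hc'] at this
    rw [this]; ring
  refine ⟨c, dslope f 0, ⟨hd, fun m => ?_⟩, he⟩
  obtain ⟨k, hk⟩ := hf.2 (m + 1)
  refine ⟨k, ?_⟩
  have h1 : iteratedDeriv (m + 1) f 0 = (m + 1) * iteratedDeriv m (dslope f 0) 0 := by
    have : f = fun q => c + (fun q : ℂ => q * dslope f 0 q) q := funext he
    have h0 : iteratedDeriv (m + 1) f 0 =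
        iteratedDeriv (m + 1) (fun q : ℂ => q * dslope f 0 q) 0 := by
      conv_lhs => rw [this]
      simp only [iteratedDeriv_const_add (n := m + 1) (by omega) (c : ℂ)]
    rw [h0, iteratedDeriv_fun_mul (f := fun q : ℂ => q) (by fun_prop) (IA_cd hd (m + 1)),
      Finset.sum_eq_single_of_mem 1 (by simp)]
    · simp
    · intro i _ hi
      rcases i with _ | _ | i
      · simp
      · simp at hi
      · have h : deriv (fun x : ℂ => x) = fun _ => 1 := by ext; simp
        rw [iteratedDeriv_succ', h]
        simp [iteratedDeriv_const]
  rw [hk, Nat.factorial_succ] at h1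
  have h3 : (m + 1 : ℂ) ≠ 0 := by exact_mod_cast Nat.succ_ne_zero m
  apply mul_left_cancel₀ h3
  rw [← h1]; push_cast; ring

lemma IA.limit {ι : Type*} {l : Filter ι} [l.NeBot] {F : ι → ℂ → ℂ} {f : ℂ → ℂ} (hF : ∀ i, IA (F i))
    (h : TendstoLocallyUniformlyOn F f l (Metric.ball 0 1)) : IA f := by
  have hd : ∀ m, DifferentiableOn ℂ (iteratedDeriv m f) (Metric.ball 0 1) ∧
      (∀ i, DifferentiableOn ℂ (iteratedDeriv m (F i)) (Metric.ball 0 1)) ∧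
      TendstoLocallyUniformlyOn (fun i => iteratedDeriv m (F i)) (iteratedDeriv m f) l
        (Metric.ball 0 1) := by
    intro m
    induction m with
    | zero =>
      simp only [iteratedDeriv_zero]
      exact ⟨h.differentiableOn (.of_forall fun i => (hF i).1) Metric.isOpen_ball,
        fun i => (hF i).1, h⟩
    | succ m ih =>
      obtain ⟨h1, h2, h3⟩ := ih
      simp only [iteratedDeriv_succ]
      exact ⟨h1.deriv Metric.isOpen_ball, fun i => (h2 i).deriv Metric.isOpen_ball,
        h3.deriv (.of_forall h2) Metric.isOpen_ball⟩
  refine ⟨by simpa using (hd 0).1, fun m => ?_⟩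
  have ht := (hd m).2.2.tendsto_at IA_mem
  have hc : IsClosed (Set.range (fun k : ℤ => (k : ℂ))) :=
    Complex.isClosedEmbedding_intCast.isClosed_range
  have h3 : (m.factorial : ℂ) ≠ 0 := by exact_mod_cast m.factorial_ne_zero
  have hmem := hc.mem_of_tendsto (ht.div_const (m.factorial : ℂ)) (.of_forall fun i => by
    obtain ⟨k, hk⟩ := (hF i).2 m
    exact ⟨k, by simp only [hk]; field_simp⟩)
  obtain ⟨k, hk⟩ := hmem
  refine ⟨k, ?_⟩
  simp only at hk
  rw [hk]; field_simp

/-- The eta product to the 24th power, as a function of `q`. -/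
def UU (q : ℂ) : ℂ := ∏' n : ℕ, (1 - q ^ (n + 1)) ^ 24

lemma UU_eq {q : ℂ} (hq : q ∈ Metric.ball (0 : ℂ) 1) :
    UU q = (∏' n : ℕ, (1 - q ^ (n + 1))) ^ 24 :=
  (ModularForm.multipliable_one_sub_pow (by simpa using hq)).tprod_pow 24

lemma IA_UU : IA UU := by
  have h : IA (fun q => ∏' n : ℕ, (1 - q ^ (n + 1))) := by
    have h1 := ModularForm.multipliableLocallyUniformlyOn_one_sub_pow.hasProdLocallyUniformlyOn
    refine IA.limit (fun s => ?_) h1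
    have := IA.prod (f := fun (n : ℕ) q => 1 + ((-1 : ℤ) : ℂ) * q ^ (n + 1))
      (fun n => IA_one.add ((IA_const (-1)).mul (IA_id.pow (n + 1)))) s
    simpa [sub_eq_add_neg] using this
  exact (h.pow 24).congr fun q hq => UU_eq hq

lemma UU_zero : UU 0 = 1 := by simp [UU]

lemma UU_ne {q : ℂ} (hq : q ∈ Metric.ball (0 : ℂ) 1) : UU q ≠ 0 := by
  rw [UU_eq hq]
  have hq' : ‖q‖ < 1 := by simpa using hq
  apply pow_ne_zero
  have := tprod_one_add_ne_zero_of_summable (f := fun n : ℕ => -q ^ (n + 1)) ?_ ?_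
  · simpa [sub_eq_add_neg] using this
  · intro i h
    have h1 : q ^ (i + 1) = 1 := by linear_combination -h
    have h2 : ‖q‖ ^ (i + 1) = 1 := by rw [← norm_pow, h1, norm_one]
    have h3 : ‖q‖ ^ (i + 1) < 1 := pow_lt_one₀ (norm_nonneg _) hq' (by omega)
    linarith
  · simpa using (summable_nat_add_iff 1).mpr (summable_geometric_of_lt_one (norm_nonneg _) hq')

lemma qexp_mem {z : ℂ} (hz : 0 < z.im) : qexp z ∈ Metric.ball (0 : ℂ) 1 := by
  simpa [qexp] using UpperHalfPlane.norm_exp_two_pi_I_lt_one ⟨z, hz⟩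

lemma qexp_ne (z : ℂ) : qexp z ≠ 0 := Complex.exp_ne_zero _

lemma qexp_hasDeriv (z : ℂ) : HasDerivAt qexp (2 * Real.pi * Complex.I * qexp z) z := by
  have h : HasDerivAt (fun z : ℂ => 2 * Real.pi * Complex.I * z) (2 * Real.pi * Complex.I) z := by
    simpa using (hasDerivAt_id z).const_mul (2 * Real.pi * Complex.I : ℂ)
  have := h.cexp
  exact this.congr_deriv (mul_comm _ _)

lemma qexp_add_one (z : ℂ) : qexp (z + 1) = qexp z := by
  unfold qexp
  rw [mul_add, mul_one, Complex.exp_add, Complex.exp_two_pi_mul_I, mul_one]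

lemma primitive (n : ℕ) : ∀ W : ℂ → ℂ, IA W → ∃ (H : ℂ → ℂ) (c : ℤ),
    (∀ z : ℂ, 0 < z.im →
      HasDerivAt H (2 * Real.pi * Complex.I * ((qexp z ^ n)⁻¹ * W (qexp z))) z) ∧
    ∀ z : ℂ, 0 < z.im → H (z + 1) = H z + 2 * Real.pi * Complex.I * c := by
  induction n with
  | zero =>
    intro W hW
    obtain ⟨c, g, hg, he⟩ := hW.split
    obtain ⟨Q, hQ⟩ := hg.1.isExactOn_ball
    refine ⟨fun z => 2 * Real.pi * Complex.I * c * z + Q (qexp z), c, fun z hz => ?_, fun z hz => ?_⟩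
    · have h1 := (hQ _ (qexp_mem hz)).comp z (qexp_hasDeriv z)
      have h2 := ((hasDerivAt_id z).const_mul (2 * Real.pi * Complex.I * c : ℂ)).add h1
      refine h2.congr_deriv ?_
      rw [he]; simp; ring
    · simp only [qexp_add_one]; ring
  | succ n ih =>
    intro W hW
    obtain ⟨c, g, hg, he⟩ := hW.split
    obtain ⟨H, d, h1, h2⟩ := ih g hg
    refine ⟨fun z => -(c / (n + 1)) * (qexp z ^ (n + 1))⁻¹ + H z, d, fun z hz => ?_, fun z hz => ?_⟩
    · have hq := qexp_ne z
      have h3 := (((qexp_hasDeriv z).fun_pow (n + 1)).fun_inv (pow_ne_zero _ hq)).const_mul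
        (-(c / (n + 1)) : ℂ)
      have h4 := h3.add (h1 z hz)
      refine h4.congr_deriv ?_
      have hn : (n + 1 : ℂ) ≠ 0 := by exact_mod_cast Nat.succ_ne_zero n
      rw [he]
      push_cast
      field_simp
      ring
    · simp only [qexp_add_one, h2 z hz]; ring

lemma Disc_eq (z : ℂ) : Disc z = qexp z * UU (qexp z) := rfl

lemma Disc_mf (z : UpperHalfPlane) : Disc z = ModularForm.discriminant z := by
  rw [ModularForm.discriminant_eq_q_prod]
  simp [Disc, qexp, Function.Periodic.qParam, ModularForm.eta_q]

lemma im_S {z : ℂ} (hz : 0 < z.im) : 0 < (-1 / z).im := by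
  have h := UpperHalfPlane.im_inv_neg_coe_pos ⟨z, hz⟩
  rwa [inv_neg, ← one_div, ← neg_div] at h

lemma ne_of_im {z : ℂ} (hz : 0 < z.im) : z ≠ 0 := by rintro rfl; simp at hz

lemma S_coe (z : UpperHalfPlane) : ((ModularGroup.S • z : UpperHalfPlane) : ℂ) = -1 / z := by
  rw [UpperHalfPlane.modular_S_smul]
  simp [neg_div]

lemma Disc_S {z : ℂ} (hz : 0 < z.im) : Disc (-1 / z) = z ^ 12 * Disc z := by
  have h := congrFun ModularForm.discriminant_S_invariant ⟨z, hz⟩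
  rw [ModularForm.SL_slash_apply, ← Disc_mf, ← Disc_mf, S_coe, ModularGroup.denom_S] at h
  have hz0 := ne_of_im hz
  simp only at h
  rw [← h]
  rw [zpow_neg]
  norm_cast
  field_simp

open ModularForm EisensteinSeries in
lemma Eis_mf (z : UpperHalfPlane) : Eis 4 z = E₄ z := by
  have h : E₄ z = (1 / 2 : ℂ) * ∑' v : gammaSet 1 1 0, eisSummand 4 v z := rfl
  rw [h, Eis, if_neg (by norm_num)]
  congr 1
  rw [tsum_subtype (gammaSet 1 1 0) (fun v => eisSummand 4 v z), ← (finTwoArrowEquiv ℤ).tsum_eq]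
  refine tsum_congr fun v => ?_
  simp only [finTwoArrowEquiv, Set.indicator, gammaSet_one_mem_iff, eisSummand]
  congr 1
  rw [zpow_neg]; norm_cast; simp

open ModularForm in
lemma Eis_S {z : ℂ} (hz : 0 < z.im) : Eis 4 (-1 / z) = z ^ 4 * Eis 4 z := by
  have h := congrFun (SlashInvariantFormClass.slash_action_eq E₄
    (Matrix.SpecialLinearGroup.mapGL ℝ ModularGroup.S) ⟨_, rfl⟩) ⟨z, hz⟩
  change ((⇑E₄ : UpperHalfPlane → ℂ) ∣[(4 : ℤ)] ModularGroup.S) _ = _ at h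
  rw [ModularForm.SL_slash_apply, ← Eis_mf, ← Eis_mf, S_coe, ModularGroup.denom_S] at h
  have hz0 := ne_of_im hz
  simp only at h
  rw [← h]
  rw [zpow_neg]
  norm_cast
  field_simp

/-- `E₄` as a function of `q`. -/
def EC : ℂ → ℂ := UpperHalfPlane.cuspFunction 1 ModularForm.E₄

lemma EC_eq {z : ℂ} (hz : 0 < z.im) : Eis 4 z = EC (qexp z) := by
  have := SlashInvariantFormClass.eq_cuspFunction ModularForm.E₄ ⟨z, hz⟩ one_mem_strictPeriods_SL one_ne_zero
  rw [← Eis_mf] at this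
  rw [← this]
  simp [EC, Function.Periodic.qParam, qexp]
 
lemma EC_diff : DifferentiableOn ℂ EC (Metric.ball 0 1) := by
  intro q hq
  exact (ModularFormClass.differentiableAt_cuspFunction ModularForm.E₄ one_pos one_mem_strictPeriods_SL (by simpa using hq)).differentiableWithinAt

/-- `(E₄ - 1) / 240` as a function of `q`. -/
def AA (q : ℂ) : ℂ := (EC q - 1) / 240

lemma IA_AA : IA AA := by
  refine ⟨?_, fun m => ?_⟩
  · exact (EC_diff.sub_const 1).div_const 240
  · have h := EisensteinSeries.E_qExpansion_coeff (k := 4) (by norm_num) (by decide) m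
    rw [UpperHalfPlane.qExpansion_coeff] at h
    have h3 : (m.factorial : ℂ) ≠ 0 := by exact_mod_cast m.factorial_ne_zero
    have hb : _root_.bernoulli 4 = -1 / 30 := by simp [_root_.bernoulli, bernoulli'_four]; norm_num
    rw [hb] at h
    change _ * iteratedDeriv m EC 0 = _ at h
    have h4 : iteratedDeriv m EC 0 = (m.factorial : ℂ) * 
       (if m = 0 then 1 else 240 * ArithmeticFunction.sigma 3 m) := by
      rw [inv_mul_eq_iff_eq_mul₀ h3] at h
      rw [h]
      split_ifs <;> norm_num
    have h5 : AA = fun q => (1 / 240 : ℂ) * (EC q - 1) := by ext q; simp only [AA]; ring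
    rcases m with _ | m
    · refine ⟨0, ?_⟩
      have : EC 0 = 1 := by simpa using h4
      simp [AA, this]
    · refine ⟨ArithmeticFunction.sigma 3 (m + 1), ?_⟩
      rw [h5, iteratedDeriv_const_mul_field]
      have h6 : iteratedDeriv (m + 1) (fun q => EC q - 1) 0 = iteratedDeriv (m + 1) EC 0 := by
        have := iteratedDeriv_const_add (n := m + 1) (f := EC) (x := 0) (by omega) (-1 : ℂ)
        rw [← this]; congr 1; ext q; ring
      rw [h6, h4, if_neg (by omega)]
      push_cast; ring

lemma Disc_ne {z : ℂ} (hz : 0 < z.im) : Disc z ≠ 0 :=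
  mul_ne_zero (qexp_ne z) (UU_ne (qexp_mem hz))

lemma Disc_hasDeriv {z : ℂ} (hz : 0 < z.im) :
    HasDerivAt Disc (2 * Real.pi * Complex.I * qexp z *
      (UU (qexp z) + qexp z * deriv UU (qexp z))) z := by
  have h1 : HasDerivAt UU (deriv UU (qexp z)) (qexp z) :=
    (IA_UU.1.differentiableAt (Metric.isOpen_ball.mem_nhds (qexp_mem hz))).hasDerivAt
  have h2 := (qexp_hasDeriv z).mul (h1.comp z (qexp_hasDeriv z))
  refine HasDerivAt.congr_deriv (f := Disc) h2 ?_
  simp only [Function.comp]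
  ring

lemma Disc_add_one (z : ℂ) : Disc (z + 1) = Disc z := by
  rw [Disc_eq, Disc_eq, qexp_add_one]

lemma jinv_S {z : ℂ} (hz : 0 < z.im) : jinv (-1 / z) = jinv z := by
  have h0 := ne_of_im hz
  have hD := Disc_ne hz
  rw [jinv, jinv, Disc_S hz, Eis_S hz]
  field_simp

lemma upper_nhds {z : ℂ} (hz : 0 < z.im) : ∀ᶠ w in 𝓝 z, 0 < w.im :=
  Complex.continuous_im.continuousAt.eventually (lt_mem_nhds hz)

lemma jinv_cont {z : ℂ} (hz : 0 < z.im) : ContinuousAt jinv z := by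
  have h1 : ContinuousAt EC (qexp z) :=
    (EC_diff.differentiableAt (Metric.isOpen_ball.mem_nhds (qexp_mem hz))).continuousAt
  have h2 : ContinuousAt (fun w => EC (qexp w)) z :=
    ContinuousAt.comp (g := EC) h1 (qexp_hasDeriv z).continuousAt
  have h3 : ContinuousAt (Eis 4) z := h2.congr (by
    filter_upwards [upper_nhds hz] with w hw using (EC_eq hw).symm)
  exact (h3.pow 3).div (Disc_hasDeriv hz).continuousAt (Disc_ne hz)

lemma S_hasDeriv {z : ℂ} (h0 : z ≠ 0) : HasDerivAt (fun w : ℂ => -1 / w) (1 / z ^ 2) z := by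
  have := (hasDerivAt_inv h0).const_mul (-1 : ℂ)
  refine HasDerivAt.congr_deriv (f := fun w : ℂ => -1 / w) ?_
    (show (-1 : ℂ) * -(z ^ 2)⁻¹ = 1 / z ^ 2 by ring)
  simpa [div_eq_mul_inv] using this

lemma Disc_deriv_S {z : ℂ} (hz : 0 < z.im) :
    deriv Disc (-1 / z) / z ^ 2 = 12 * z ^ 11 * Disc z + z ^ 12 * deriv Disc z := by
  have h1 := (Disc_hasDeriv (im_S hz)).differentiableAt.hasDerivAt.comp z (S_hasDeriv (ne_of_im hz))
  have h2 := (hasDerivAt_pow 12 z).mul (Disc_hasDeriv hz).differentiableAt.hasDerivAt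
  have h3 := h1.congr_of_eventuallyEq (f₁ := (fun x : ℂ => x ^ 12) * Disc) (by
    filter_upwards [upper_nhds hz] with w hw
    simp [Disc_S hw])
  have h4 := h3.unique h2
  rw [div_eq_mul_one_div, h4]
  norm_num

lemma exists_H (n : ℕ) (hn : 1 ≤ n) : ∃ (H : ℂ → ℂ) (c : ℤ),
    (∀ z : ℂ, 0 < z.im → HasDerivAt H (jinv z ^ n * (deriv Disc z / Disc z)) z) ∧
    ∀ z : ℂ, 0 < z.im → H (z + 1) = H z + 240 * (2 * Real.pi * Complex.I * c) := by
  have hV : IA (fun q => (UU q)⁻¹) := IA_UU.inv UU_zero (fun q hq => UU_ne hq)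
  have hE : IA EC := by
    refine (IA_one.add ((IA_const 240).mul IA_AA)).congr fun q _ => ?_
    simp only [AA]; push_cast; ring
  have hK : IA (fun q => ∑ i ∈ Finset.range (3 * n), EC q ^ i) := IA.sum (fun i => hE.pow i) _
  have hW := ((hV.pow n).mul (IA_AA.mul hK)).mul (IA_one.add (IA_id.mul (IA_UU.der.mul hV)))
  obtain ⟨H, c, h1, h2⟩ := primitive n _ hW
  refine ⟨fun z => -(1 / n) * (Disc z ^ n)⁻¹ + 240 * H z, c, fun z hz => ?_, fun z hz => ?_⟩
  · have hD := Disc_ne hz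
    have h3 := (((Disc_hasDeriv hz).fun_pow n).fun_inv (pow_ne_zero _ hD)).const_mul
      (-(1 / n) : ℂ)
    have h4 := h3.add ((h1 z hz).const_mul 240)
    refine h4.congr_deriv ?_
    rw [(Disc_hasDeriv hz).deriv, jinv, EC_eq hz, Disc_eq]
    have hq := qexp_ne z
    have hU := UU_ne (qexp_mem hz)
    have hg : EC (qexp z) ^ (3 * n) = 1 + 240 * (AA (qexp z) *
        ∑ i ∈ Finset.range (3 * n), EC (qexp z) ^ i) := by
      have := mul_geom_sum (EC (qexp z)) (3 * n)
      rw [AA]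
      linear_combination -this
    have hn0 : (n : ℂ) ≠ 0 := by exact_mod_cast (by omega : n ≠ 0)
    have hg' : (EC (qexp z) ^ 3) ^ n = 1 + 240 * (AA (qexp z) *
        ∑ i ∈ Finset.range (3 * n), EC (qexp z) ^ i) := by
      rw [← pow_mul]; exact hg
    rw [div_pow, hg']
    clear hg hg' h3 h4
    generalize (∑ i ∈ Finset.range (3 * n), EC (qexp z) ^ i) = K
    generalize deriv UU (qexp z) = U'
    generalize UU (qexp z) = U at *
    generalize qexp z = q at *
    generalize AA q = A
    obtain ⟨m, rfl⟩ : ∃ m, n = m + 1 := ⟨n - 1, by omega⟩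
    simp only [Nat.add_sub_cancel, inv_pow]
    field_simp
    ring
  · simp only [h2 z hz, Disc_add_one]; ring

lemma arc_im {θ : ℝ} (h : θ ∈ Set.uIcc (Real.pi / 2) (2 * Real.pi / 3)) :
    0 < (Complex.exp (θ * Complex.I)).im := by
  have hp := Real.pi_pos
  rw [Set.uIcc_of_le (by linarith)] at h
  rw [Complex.exp_ofReal_mul_I_im]
  exact Real.sin_pos_of_pos_of_lt_pi (by linarith [h.1]) (by linarith [h.2])

/-- For every `n ≥ 1`, `(1/2π) ∫_{π/2}^{2π/3} j(e^{iθ})^n dθ`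
is an integer. -/
theorem arc_integral_is_integer (n : ℕ) (hn : 1 ≤ n) :
    ∃ z : ℤ,
      (1 / (2 * Real.pi)) *
          ∫ θ in (Real.pi / 2)..(2 * Real.pi / 3), jinv (Complex.exp (θ * Complex.I)) ^ n
        = (z : ℂ) := by
  obtain ⟨H, c, h1, h2⟩ := exists_H n hn
  refine ⟨20 * c, ?_⟩
  have hK : ∀ z : ℂ, 0 < z.im → HasDerivAt (fun w => H (-1 / w) - H w) (12 * jinv z ^ n / z) z := by
    intro z hz
    have h0 := ne_of_im hz
    have h3 := ((h1 _ (im_S hz)).comp z (S_hasDeriv h0)).sub (h1 z hz)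
    refine HasDerivAt.congr_deriv (f := fun w => H (-1 / w) - H w) h3 ?_
    have hd := Disc_deriv_S hz
    have hD := Disc_ne hz
    rw [jinv_S hz, Disc_S hz]
    rw [div_eq_iff (pow_ne_zero 2 h0)] at hd
    rw [hd]
    field_simp
    ring
  have hf : ∀ θ ∈ Set.uIcc (Real.pi / 2) (2 * Real.pi / 3),
      HasDerivAt (fun t : ℝ => H (-1 / Complex.exp (t * Complex.I)) - H (Complex.exp (t * Complex.I)))
        (12 * Complex.I * jinv (Complex.exp (θ * Complex.I)) ^ n) θ := by
    intro θ hθ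
    have hz := arc_im hθ
    have h3 : HasDerivAt (fun t : ℝ => Complex.exp (t * Complex.I))
        (Complex.exp (θ * Complex.I) * Complex.I) θ := by
      have := ((hasDerivAt_id (θ : ℂ)).mul_const Complex.I).cexp.comp_ofReal
      simpa using this
    have h4 := (hK _ hz).comp θ h3
    refine HasDerivAt.congr_deriv (f := fun t : ℝ => H (-1 / Complex.exp (t * Complex.I)) -
      H (Complex.exp (t * Complex.I))) h4 ?_
    have := Complex.exp_ne_zero (θ * Complex.I)
    field_simp
  have hInt : IntervalIntegrable
      (fun θ : ℝ => 12 * Complex.I * jinv (Complex.exp (θ * Complex.I)) ^ n) volume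
      (Real.pi / 2) (2 * Real.pi / 3) := by
    apply ContinuousOn.intervalIntegrable
    intro θ hθ
    have h3 : ContinuousAt (fun t : ℝ => jinv (Complex.exp (t * Complex.I))) θ :=
      ContinuousAt.comp (g := jinv) (jinv_cont (arc_im hθ)) (by fun_prop)
    exact (continuousAt_const.mul (h3.pow n)).continuousWithinAt
  have hI := intervalIntegral.integral_eq_sub_of_hasDerivAt hf hInt
  rw [intervalIntegral.integral_const_mul] at hI
  have e1 : Complex.exp ((Real.pi / 2 : ℝ) * Complex.I) = Complex.I := by
    push_cast
    exact Complex.exp_pi_div_two_mul_I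
  have e2 : -1 / Complex.exp ((2 * Real.pi / 3 : ℝ) * Complex.I) =
      Complex.exp ((2 * Real.pi / 3 : ℝ) * Complex.I) + 1 := by
    have hc : Real.cos (2 * Real.pi / 3) = -1 / 2 := by
      rw [show 2 * Real.pi / 3 = Real.pi - Real.pi / 3 by ring, Real.cos_pi_sub, Real.cos_pi_div_three]
      norm_num
    have hs : Real.sin (2 * Real.pi / 3) = √3 / 2 := by
      rw [show 2 * Real.pi / 3 = Real.pi - Real.pi / 3 by ring, Real.sin_pi_sub,
        Real.sin_pi_div_three]
    have hw : Complex.exp ((2 * Real.pi / 3 : ℝ) * Complex.I) = -1 / 2 + (√3 : ℝ) / 2 * Complex.I := by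
      rw [Complex.exp_mul_I, ← Complex.ofReal_cos, ← Complex.ofReal_sin, hc, hs]
      push_cast; ring
    rw [div_eq_iff (Complex.exp_ne_zero _), hw]
    have h3 : ((√3 : ℝ) : ℂ) ^ 2 = 3 := by
      rw [← Complex.ofReal_pow, Real.sq_sqrt (by norm_num)]; norm_num
    linear_combination -(1 / 4) * Complex.I ^ 2 * h3 - (3 / 4) * Complex.I_sq
  have e3 : -1 / Complex.I = Complex.I := by
    rw [div_eq_iff Complex.I_ne_zero]; simp
  rw [e1, e2, e3, h2 _ (arc_im Set.right_mem_uIcc)] at hI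
  have hpi : (Real.pi : ℂ) ≠ 0 := by exact_mod_cast Real.pi_ne_zero
  have h5 : ∫ θ in (Real.pi / 2)..(2 * Real.pi / 3), jinv (Complex.exp (θ * Complex.I)) ^ n
      = 40 * Real.pi * c := by
    apply mul_left_cancel₀ (mul_ne_zero (by norm_num : (12 : ℂ) ≠ 0) Complex.I_ne_zero)
    rw [hI]; ring
  rw [h5]
  push_cast
  field_simp
  ring
end
end

section
/- For every integer n ≥ 1, the coefficient c_n(0) of q^0 in the q-expansion of j^n satisfies c_n(0) = ∫_{π/3}^{2π/3} sin(θ) · j(e^{iθ})^n dθ, where j is real-valued on the unit-circle arc {e^{iθ} : π/3 ≤ θ ≤ 2π/3}. -/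
open Complex Polynomial Real MeasureTheory Filter Topology

noncomputable section

lemma aux_Eis_eq (τ : UpperHalfPlane) : Eis 4 (τ : ℂ) = ModularForm.E₄ τ := by
  have h : ModularForm.E₄ τ = (1 / 2 : ℂ) * eisensteinSeries (N := 1) 0 4 τ := rfl
  rw [h, Eis, if_neg (by norm_num), eisensteinSeries]
  congr 1
  rw [tsum_subtype (EisensteinSeries.gammaSet 1 1 0)
    (fun v => EisensteinSeries.eisSummand 4 v τ), ← (finTwoArrowEquiv ℤ).tsum_eq]
  refine tsum_congr fun v => ?_
  rw [show finTwoArrowEquiv ℤ v = (v 0, v 1) from rfl]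
  simp only [Set.indicator, EisensteinSeries.gammaSet_one_mem_iff, EisensteinSeries.eisSummand,
    zpow_neg]
  split_ifs
  · rw [one_div]; norm_cast
  · rfl

lemma aux_Disc_eq (τ : UpperHalfPlane) : Disc (τ : ℂ) = ModularForm.discriminant τ := by
  rw [ModularForm.discriminant_eq_q_prod, Disc]
  simp [qexp, ModularForm.eta_q, Function.Periodic.qParam]

lemma aux_jinv_eq (τ : UpperHalfPlane) :
    jinv (τ : ℂ) = ModularForm.E₄ τ ^ 3 / ModularForm.discriminant τ := by
  rw [jinv, aux_Eis_eq, aux_Disc_eq]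

lemma aux_E4_slash (γ : Matrix.SpecialLinearGroup (Fin 2) ℤ) :
    SlashAction.map (4 : ℤ) γ (ModularForm.E₄ : UpperHalfPlane → ℂ) = ModularForm.E₄ :=
  SlashInvariantFormClass.slash_action_eq ModularForm.E₄ _ ⟨γ, rfl⟩

lemma aux_jinv_add_one {z : ℂ} (hz : 0 < z.im) : jinv (z + 1) = jinv z := by
  set τ : UpperHalfPlane := ⟨z, hz⟩
  have h1 : z + 1 = (((1 : ℝ) +ᵥ τ : UpperHalfPlane) : ℂ) := by
    rw [UpperHalfPlane.coe_vadd]; simp [τ, add_comm]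
  have h2 : z = (τ : ℂ) := rfl
  rw [h1, h2, aux_jinv_eq, aux_jinv_eq]
  rw [SlashInvariantForm.vAdd_apply_of_mem_strictPeriods ModularForm.E₄ τ one_mem_strictPeriods_SL]
  have := SlashInvariantForm.vAdd_apply_of_mem_strictPeriods CuspForm.discriminant τ
    one_mem_strictPeriods_SL
  simp only [CuspForm.coe_discriminant] at this
  rw [this]

lemma aux_alg (t a d : ℂ) (ht : t ≠ 0) :
    a ^ 3 / d = (a * t ^ (-4 : ℤ)) ^ 3 / (d * t ^ (-12 : ℤ)) := by
  have h : t ^ (-12 : ℤ) = (t ^ (-4 : ℤ)) ^ 3 := by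
    rw [← zpow_natCast, ← zpow_mul]; norm_num
  have h4 : (t ^ (-4 : ℤ)) ^ 3 ≠ 0 := pow_ne_zero _ (zpow_ne_zero _ ht)
  rw [h, mul_pow, mul_div_mul_right _ _ h4]

lemma aux_jinv_S' (τ : UpperHalfPlane) : jinv ((-(τ : ℂ))⁻¹) = jinv τ := by
  have e4 := SlashInvariantForm.slash_S_apply ModularForm.E₄ 4 τ
  rw [aux_E4_slash] at e4
  have d := SlashInvariantForm.slash_S_apply ModularForm.discriminant 12 τ
  rw [ModularForm.discriminant_S_invariant] at d
  rw [aux_jinv_eq τ, e4, d, ← aux_alg _ _ _ τ.ne_zero]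
  exact aux_jinv_eq (UpperHalfPlane.mk _ τ.im_inv_neg_coe_pos)

lemma aux_jinv_S {z : ℂ} (hz : 0 < z.im) : jinv ((-z)⁻¹) = jinv z :=
  aux_jinv_S' ⟨z, hz⟩

lemma aux_jinv_diff : DifferentiableOn ℂ jinv {z : ℂ | 0 < z.im} := by
  have h1 := UpperHalfPlane.mdifferentiable_iff.mp ModularForm.E₄.holo'
  have h2 := UpperHalfPlane.mdifferentiable_iff.mp CuspForm.discriminant.holo'
  refine ((h1.fun_pow 3).fun_div h2 ?_).congr ?_
  · intro z hz
    exact ModularForm.discriminant_ne_zero _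
  · intro z hz
    have := aux_jinv_eq ⟨z, hz⟩
    simp only [Function.comp, UpperHalfPlane.ofComplex_apply_of_im_pos hz]
    exact this

/-- The contour shift: integral over the horizontal segment equals the arc integral. -/
lemma aux_contour {f : ℂ → ℂ} (hf : DifferentiableOn ℂ f {z : ℂ | 0 < z.im})
    (hper : ∀ z : ℂ, 0 < z.im → f (z + 1) = f z) :
    ∫ x in (0:ℝ)..1, f (x + Complex.I) =
      ∫ θ in (Real.pi / 3)..(2 * Real.pi / 3),
        f (Complex.exp (θ * Complex.I)) * (-(Complex.exp (θ * Complex.I) * Complex.I)) := by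
  have hball : Metric.ball (2 * Complex.I) 2 ⊆ {z : ℂ | 0 < z.im} := by
    intro z hz
    rw [Metric.mem_ball, dist_eq_norm] at hz
    have := (Complex.abs_im_le_norm (z - 2 * Complex.I)).trans_lt hz
    simp at this
    have := (abs_lt.mp this).1
    simp; linarith
  have hmem : ∀ z : ℂ, z.re ^ 2 + (z.im - 2) ^ 2 < 4 → z ∈ Metric.ball (2 * Complex.I) 2 := by
    intro z hz
    rw [Metric.mem_ball, dist_eq_norm, ← sq_lt_sq₀ (norm_nonneg _) (by norm_num),
      Complex.sq_norm, Complex.normSq_apply]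
    simp
    nlinarith
  obtain ⟨F, hF⟩ := (hf.mono hball).isExactOn_ball
  have path : ∀ (γ γ' : ℝ → ℂ) (a b : ℝ), (∀ t, HasDerivAt γ (γ' t) t) → Continuous γ' →
      (∀ t ∈ Set.uIcc a b, γ t ∈ Metric.ball (2 * Complex.I) 2) →
      ∫ t in a..b, f (γ t) * γ' t = F (γ b) - F (γ a) := by
    intro γ γ' a b hγ hγ' hm
    have hc : Continuous γ := continuous_iff_continuousAt.mpr fun t => (hγ t).continuousAt
    refine intervalIntegral.integral_eq_sub_of_hasDerivAt (f := fun t => F (γ t))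
      (fun t ht => (hF _ (hm t ht)).comp_of_eq t (hγ t) rfl) ?_
    refine ContinuousOn.intervalIntegrable ?_
    exact ((hf.mono hball).continuousOn.comp hc.continuousOn hm).mul hγ'.continuousOn
  have hs3 : Real.sqrt 3 ^ 2 = 3 := Real.sq_sqrt (by norm_num)
  have hs0 : 0 ≤ Real.sqrt 3 := Real.sqrt_nonneg 3
  have hs1 : 1 < Real.sqrt 3 := by nlinarith
  have hs2 : Real.sqrt 3 < 2 := by nlinarith
  -- horizontal
  have hor : ∫ x in (0:ℝ)..1, f (x + Complex.I) =
      F ((1 / 2 : ℝ) + Complex.I) - F ((-1 / 2 : ℝ) + Complex.I) := by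
    have hp : Function.Periodic (fun x : ℝ => f (x + Complex.I)) 1 := by
      intro x
      have := hper (x + Complex.I) (by simp)
      simp only []
      rw [← this]; congr 1; push_cast; ring
    have h1 := hp.intervalIntegral_add_eq 0 (-1 / 2)
    rw [zero_add, show (-1 / 2 + 1 : ℝ) = 1 / 2 by norm_num] at h1
    rw [h1]
    have := path (fun x => x + Complex.I) (fun _ => 1) (-1 / 2) (1 / 2)
      (fun t => (Complex.ofRealCLM.hasDerivAt (x := t)).add_const Complex.I) continuous_const ?_
    · simpa using this
    · intro t ht
      rw [Set.uIcc_of_le (by norm_num)] at ht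
      apply hmem
      simp
      nlinarith [ht.1, ht.2]
  have ver : ∀ c : ℝ, c ^ 2 ≤ 1 / 4 →
      ∫ t in (Real.sqrt 3 / 2)..1, f (c + t * Complex.I) * Complex.I =
      F (c + Complex.I) - F (c + (Real.sqrt 3 / 2 : ℝ) * Complex.I) := by
    intro c hc
    have := path (fun t => c + t * Complex.I) (fun _ => 1 * Complex.I) (Real.sqrt 3 / 2) 1
      (fun t => ((Complex.ofRealCLM.hasDerivAt (x := t)).mul_const Complex.I).const_add (c : ℂ))
      continuous_const ?_
    · simpa using this
    · intro t ht
      rw [Set.uIcc_of_le (by linarith)] at ht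
      apply hmem
      simp
      nlinarith [ht.1, ht.2]
  have arc := path (fun θ => Complex.exp (θ * Complex.I))
    (fun θ => Complex.exp (θ * Complex.I) * (1 * Complex.I)) (Real.pi / 3) (2 * Real.pi / 3)
    (fun t => ((Complex.ofRealCLM.hasDerivAt (x := t)).mul_const Complex.I).cexp)
    (by fun_prop) ?_
  · have hv : ∫ t in (Real.sqrt 3 / 2)..1, f ((1 / 2 : ℝ) + t * Complex.I) * Complex.I =
        ∫ t in (Real.sqrt 3 / 2)..1, f ((-1 / 2 : ℝ) + t * Complex.I) * Complex.I := by
      refine intervalIntegral.integral_congr fun t ht => ?_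
      rw [Set.uIcc_of_le (by linarith)] at ht
      have := hper ((-1 / 2 : ℝ) + t * Complex.I) (by simp; linarith [ht.1])
      beta_reduce
      rw [← this]
      congr 2
      push_cast; ring
    rw [ver _ (by norm_num), ver _ (by norm_num)] at hv
    have e1 : Complex.exp ((Real.pi / 3 : ℝ) * Complex.I) =
        (1 / 2 : ℝ) + (Real.sqrt 3 / 2 : ℝ) * Complex.I := by
      rw [Complex.exp_mul_I, ← Complex.ofReal_cos, ← Complex.ofReal_sin, Real.cos_pi_div_three,
        Real.sin_pi_div_three]
    have e2 : Complex.exp ((2 * Real.pi / 3 : ℝ) * Complex.I) =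
        (-1 / 2 : ℝ) + (Real.sqrt 3 / 2 : ℝ) * Complex.I := by
      rw [Complex.exp_mul_I, ← Complex.ofReal_cos, ← Complex.ofReal_sin,
        show 2 * Real.pi / 3 = Real.pi - Real.pi / 3 by ring, Real.cos_pi_sub, Real.sin_pi_sub,
        Real.cos_pi_div_three, Real.sin_pi_div_three]
      norm_num
    rw [e1, e2] at arc
    simp only [mul_neg, intervalIntegral.integral_neg]
    simp only [one_mul] at arc
    rw [arc, hor]
    linear_combination hv
  · intro t ht
    have hpi := Real.pi_pos
    rw [Set.uIcc_of_le (by linarith)] at ht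
    apply hmem
    rw [Complex.exp_ofReal_mul_I_re, Complex.exp_ofReal_mul_I_im]
    have h1 := Real.sin_sq_add_cos_sq t
    have h2 : 1 / 2 < Real.sin t := by
      have hc : |Real.cos t| ≤ 1 / 2 := by
        rw [abs_le]
        constructor
        · have := Real.cos_le_cos_of_nonneg_of_le_pi (by linarith [ht.1]) (by linarith) ht.2
          rw [show 2 * Real.pi / 3 = Real.pi - Real.pi / 3 by ring, Real.cos_pi_sub,
            Real.cos_pi_div_three] at this
          linarith
        · have := Real.cos_le_cos_of_nonneg_of_le_pi (by linarith) (by linarith [ht.2]) ht.1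
          rwa [Real.cos_pi_div_three] at this
      have hs := Real.sin_nonneg_of_nonneg_of_le_pi (x := t) (by linarith [ht.1])
        (by linarith [ht.2])
      have := abs_le.mp hc
      nlinarith
    nlinarith

/-- For every `n ≥ 1`, the coefficient `c_n(0)` of `q^0` in `j^n`
satisfies `c_n(0) = ∫_{π/3}^{2π/3} sin(θ) j(e^{iθ})^n dθ`. -/
theorem cn_zero_as_arc_integral (n : ℕ) (hn : 1 ≤ n) :
    cj n 0
      = ∫ θ in (Real.pi / 3)..(2 * Real.pi / 3),
          (Real.sin θ : ℂ) * jinv (Complex.exp (θ * Complex.I)) ^ n := by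
  have hf : DifferentiableOn ℂ (fun z => jinv z ^ n) {z : ℂ | 0 < z.im} := aux_jinv_diff.fun_pow n
  have hpi := Real.pi_pos
  have hsin : ∀ θ ∈ Set.uIcc (Real.pi / 3) (2 * Real.pi / 3), 0 < Real.sin θ := by
    intro θ hθ
    rw [Set.uIcc_of_le (by linarith)] at hθ
    exact Real.sin_pos_of_pos_of_lt_pi (by linarith [hθ.1]) (by linarith [hθ.2])
  have hJ : ContinuousOn (fun θ : ℝ => jinv (Complex.exp (θ * Complex.I)) ^ n)
      (Set.uIcc (Real.pi / 3) (2 * Real.pi / 3)) := by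
    refine hf.continuousOn.comp (f := fun θ : ℝ => Complex.exp (θ * Complex.I))
      (by fun_prop) fun θ hθ => ?_
    simpa [Complex.exp_ofReal_mul_I_im] using hsin θ hθ
  have hcos : ∫ θ in (Real.pi / 3)..(2 * Real.pi / 3),
      (Real.cos θ : ℂ) * jinv (Complex.exp (θ * Complex.I)) ^ n = 0 := by
    have h := intervalIntegral.integral_comp_sub_left (a := Real.pi / 3) (b := 2 * Real.pi / 3)
      (fun θ : ℝ => (Real.cos θ : ℂ) * jinv (Complex.exp (θ * Complex.I)) ^ n) Real.pi
    rw [show Real.pi - 2 * Real.pi / 3 = Real.pi / 3 by ring,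
      show Real.pi - Real.pi / 3 = 2 * Real.pi / 3 by ring] at h
    have h2 : ∫ θ in (Real.pi / 3)..(2 * Real.pi / 3),
        (Real.cos (Real.pi - θ) : ℂ) *
          jinv (Complex.exp ((Real.pi - θ : ℝ) * Complex.I)) ^ n =
        ∫ θ in (Real.pi / 3)..(2 * Real.pi / 3),
          -((Real.cos θ : ℂ) * jinv (Complex.exp (θ * Complex.I)) ^ n) := by
      refine intervalIntegral.integral_congr fun θ hθ => ?_
      have hs := aux_jinv_S (z := Complex.exp (θ * Complex.I))
        (by rw [Complex.exp_ofReal_mul_I_im]; exact hsin θ hθ)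
      have he : Complex.exp ((Real.pi - θ : ℝ) * Complex.I) =
          (-Complex.exp (θ * Complex.I))⁻¹ := by
        push_cast
        rw [sub_mul, Complex.exp_sub, Complex.exp_pi_mul_I, inv_neg, neg_div, one_div]
      beta_reduce
      rw [he, hs, Real.cos_pi_sub]
      push_cast; ring
    rw [intervalIntegral.integral_neg] at h2
    have h3 := h.symm.trans h2
    linear_combination (1 / 2 : ℂ) * h3
  have h0 : cj n 0 = ∫ x in (0:ℝ)..1, (fun z => jinv z ^ n) (x + Complex.I) := by
    simp [cj, qCoeff]
  rw [h0, aux_contour hf (fun z hz => by simp only [aux_jinv_add_one hz])]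
  have hsplit : ∀ θ : ℝ, (fun z => jinv z ^ n) (Complex.exp (θ * Complex.I)) *
      (-(Complex.exp (θ * Complex.I) * Complex.I)) =
      (Real.sin θ : ℂ) * jinv (Complex.exp (θ * Complex.I)) ^ n -
        Complex.I * ((Real.cos θ : ℂ) * jinv (Complex.exp (θ * Complex.I)) ^ n) := by
    intro θ
    simp only []
    have he : Complex.exp (θ * Complex.I) = Real.cos θ + Real.sin θ * Complex.I := by
      rw [Complex.exp_mul_I, ← Complex.ofReal_cos, ← Complex.ofReal_sin]
    have hk : -(Complex.exp (θ * Complex.I) * Complex.I) =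
        Real.sin θ - Complex.I * Real.cos θ := by
      rw [he]; linear_combination (-(Real.sin θ : ℂ)) * Complex.I_sq
    rw [hk]; ring
  simp_rw [hsplit]
  rw [intervalIntegral.integral_sub, intervalIntegral.integral_const_mul, hcos]
  · simp
  · exact ContinuousOn.intervalIntegrable
      ((Continuous.continuousOn (by fun_prop)).mul hJ)
  · exact ContinuousOn.intervalIntegrable
      (continuousOn_const.mul ((Continuous.continuousOn (by fun_prop)).mul hJ))
end
end
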